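/- For all integers T ≥ B ≥ 1 and B₂ > B (with B₂/B not necessarily an integer), there exist a finite field F_q, positive integers k and n with k/n = T/(T+B), and a streaming code with source alphabet F_q^k and channel alphabet F_q^n that corrects erasure bursts of length B with delay T and also corrects erasure bursts of length B₂ with delay ⌈B₂·T/B⌉ + B. -/

import Mathlib

/-- The channel input stream produced by the streaming code `f` (a sequence of causal
encoding functions `f t : S^(t+1) → X`) from the source stream `s`. -/
def chanStream {S X : Type*} (f : ∀ t : ℕ, (Fin (t + 1) → S) → X) (s : ℕ → S) (t : ℕ) : X :=
  f t fun i => s i.val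

/-- Output at time `t` of the burst-erasure channel with burst length `B` and burst starting
position `j`: `none` (an erasure) for `j ≤ t ≤ j + B - 1`, and the channel input otherwise. -/
def burstOut {S X : Type*} (f : ∀ t : ℕ, (Fin (t + 1) → S) → X) (B j : ℕ) (s : ℕ → S)
    (t : ℕ) : Option X :=
  if j ≤ t ∧ t ≤ j + B - 1 then none else some (chanStream f s t)

/-- The streaming code `f` corrects erasure bursts of length `B` with delay `T`: there are
decoding functions `γ t` recovering `s t` from the channel outputs `y 0, …, y (t + T)`,
for every source stream `s` and every burst starting position `j`. -/
def Corrects {S X : Type*} (f : ∀ t : ℕ, (Fin (t + 1) → S) → X) (B T : ℕ) : Prop :=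
  ∃ γ : ∀ t : ℕ, (Fin (t + T + 1) → Option X) → S,
    ∀ (s : ℕ → S) (j t : ℕ), γ t (fun i => burstOut f B j s i.val) = s t

open Polynomial in
/-- Parity `r` of the block code. -/
noncomputable def par {F : Type} [Field F] (B m f : ℕ) (x : ℕ → F) (r : ℕ) (z : ℕ → F) : F :=
  (∑ j ∈ Finset.range m, z (r + j * B)) +
    eval (x r) (Lagrange.interpolate (Finset.range f) x (fun e => z (m * B + e)))

section block
variable {F : Type} [Field F] {B m f : ℕ} {x : ℕ → F}

lemma par_sub (r : ℕ) (z z' : ℕ → F) :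
    par B m f x r (fun l => z l - z' l) = par B m f x r z - par B m f x r z' := by
  have : (fun e => z (m * B + e) - z' (m * B + e))
      = (fun e => z (m * B + e)) - (fun e => z' (m * B + e)) := rfl
  simp only [par, this, map_sub, Polynomial.eval_sub, Finset.sum_sub_distrib]
  ring

lemma interp_zero (z : ℕ → F) (hz : ∀ e < f, z e = 0) :
    Lagrange.interpolate (Finset.range f) x z = 0 := by
  rw [Lagrange.interpolate_apply]
  apply Finset.sum_eq_zero
  intro i hi
  rw [hz i (Finset.mem_range.1 hi)]; simp

lemma par_zero (hm : 1 ≤ m) (hf : f < B) {r : ℕ} (hr : r < B) (z : ℕ → F)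
    (hz : ∀ l, r ≤ l → l < m * B + f → z l = 0) : par B m f x r z = 0 := by
  have hmB : B ≤ m * B := by nlinarith
  unfold par
  rw [interp_zero, Finset.sum_eq_zero]
  · simp
  · intro j hj
    have := Finset.mem_range.1 hj
    have : (j + 1) * B ≤ m * B := Nat.mul_le_mul_right _ this
    apply hz <;> nlinarith
  · intro e he
    apply hz <;> omega

lemma par_congr (hm : 1 ≤ m) (hf : f < B) {r : ℕ} (hr : r < B) (z z' : ℕ → F)
    (hz : ∀ l, r ≤ l → l < m * B + f → z l = z' l) :
    par B m f x r z = par B m f x r z' := by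
  rw [← sub_eq_zero, ← par_sub]
  apply par_zero hm hf hr
  intro l h1 h2
  simp [hz l h1 h2]

/-- Decoding of a low row from a single parity. -/
lemma block_low (hB : 1 ≤ B) (hf : f < B) (hx : Set.InjOn x (Finset.range B))
    (z : ℕ → F) (k : ℕ) (hk : k + B < m * B + f)
    (h1 : ∀ l, l + B ≤ k → z l = 0) (h2 : ∀ l, k + B ≤ l → l < m * B + f → z l = 0)
    (hp : par B m f x (k % B) z = 0) : z k = 0 := by
  have hkd := Nat.mod_add_div k B
  set r := k % B with hr
  set q := k / B with hq
  have hrB : r < B := Nat.mod_lt _ hB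
  have hqm : q < m := by
    by_contra h
    have : m * B ≤ q * B := Nat.mul_le_mul_right _ (by omega)
    nlinarith
  have hint : Polynomial.eval (x r)
      (Lagrange.interpolate (Finset.range f) x (fun e => z (m * B + e))) = 0 := by
    by_cases hrf : r < f
    · rw [Lagrange.eval_interpolate_at_node]
      · apply h2
        · have : (q + 1) * B ≤ m * B := Nat.mul_le_mul_right _ hqm
          nlinarith
        · omega
      · intro a ha b hb hab
        apply hx _ _ hab <;> simp at * <;> omega
      · simpa using hrf
    · rw [interp_zero]
      · simp
      · intro e he
        apply h2
        · have : q + 1 < m := by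
            by_contra h
            have : m * B ≤ (q + 1) * B := Nat.mul_le_mul_right _ (by omega)
            nlinarith
          have : (q + 1 + 1) * B ≤ m * B := Nat.mul_le_mul_right _ this
          nlinarith
        · omega
  unfold par at hp
  rw [hint, add_zero, Finset.sum_eq_single q] at hp
  · rw [← hkd, mul_comm]; exact hp
  · intro j hj hjq
    have hj := Finset.mem_range.1 hj
    rcases lt_or_gt_of_ne hjq with h | h
    · apply h1
      have : (j + 1) * B ≤ q * B := Nat.mul_le_mul_right _ h
      nlinarith
    · apply h2
      · have : (q + 1) * B ≤ j * B := Nat.mul_le_mul_right _ h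
        nlinarith
      · have : (j + 1) * B ≤ m * B := Nat.mul_le_mul_right _ hj
        nlinarith
  · intro h; exact absurd (Finset.mem_range.2 hqm) h

/-- The low-delay burst property of the block code. -/
lemma block_main (hB : 1 ≤ B) (hm : 1 ≤ m) (hf : f < B) (hx : Set.InjOn x (Finset.range B))
    (z : ℕ → F) (k : ℕ) (hk : k < m * B + f)
    (h1 : ∀ l, l < k → z l = 0) (h2 : ∀ l, k + B ≤ l → l < m * B + f → z l = 0)
    (hp : ∀ r, r < B → r ≤ k → k + B ≤ m * B + f + r → par B m f x r z = 0) : z k = 0 := by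
  have hinj : Set.InjOn x (Finset.range f) := by
    intro a ha b hb hab
    apply hx _ _ hab <;> simp at * <;> omega
  obtain ⟨n, rfl⟩ : ∃ n, m = n + 1 := ⟨m - 1, by omega⟩
  have hmB : (n + 1) * B = n * B + B := by ring
  have hjB : ∀ j < n + 1, j * B ≤ n * B := fun j hj => Nat.mul_le_mul_right _ (by omega)
  have hdeg := Lagrange.degree_interpolate_lt (fun e => z ((n + 1) * B + e)) hinj
  rw [Finset.card_range] at hdeg
  by_cases c1 : k + B < (n + 1) * B + f
  · refine block_low hB hf hx z k c1 (fun l hl => h1 l (by omega)) h2 (hp _ (Nat.mod_lt _ hB)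
      (Nat.mod_le _ _) (by omega))
  by_cases c2 : k < (n + 1) * B
  · have hP : Lagrange.interpolate (Finset.range f) x (fun e => z ((n + 1) * B + e)) = 0 := by
      have hinj2 : Set.InjOn x (Finset.Ico (k - n * B - f) (k - n * B)) := by
        intro a ha b hb hab
        apply hx _ _ hab <;> simp at * <;> omega
      apply Polynomial.eq_zero_of_degree_lt_of_eval_index_eq_zero
        (Finset.Ico (k - n * B - f) (k - n * B)) hinj2
      · rw [Nat.card_Ico]
        convert hdeg using 2
        omega
      · intro r hr
        rw [Finset.mem_Ico] at hr
        have := hp r (by omega) (by omega) (by omega)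
        unfold par at this
        rwa [Finset.sum_eq_zero, zero_add] at this
        intro j hj
        have := hjB j (Finset.mem_range.1 hj)
        apply h1; omega
    have := hp (k - n * B) (by omega) (by omega) (by omega)
    unfold par at this
    rw [hP, Finset.sum_range_succ, Finset.sum_eq_zero] at this
    · rw [show k - n * B + n * B = k by omega] at this
      simpa using this
    · intro j hj
      have : (j + 1) * B ≤ n * B := Nat.mul_le_mul_right _ (Finset.mem_range.1 hj)
      apply h1
      have : (j + 1) * B = j * B + B := by ring
      omega
  · obtain ⟨e, rfl⟩ : ∃ e, k = (n + 1) * B + e := ⟨k - (n + 1) * B, by omega⟩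
    have hP : Lagrange.interpolate (Finset.range f) x (fun e => z ((n + 1) * B + e)) = 0 := by
      have hinj2 : Set.InjOn x
          ((Finset.range e ∪ Finset.Ico (B - f + e) B : Finset ℕ) : Set ℕ) := by
        intro a ha b hb hab
        apply hx _ _ hab <;> simp at * <;> omega
      apply Polynomial.eq_zero_of_degree_lt_of_eval_index_eq_zero
        (Finset.range e ∪ Finset.Ico (B - f + e) B) hinj2
      · rw [Finset.card_union_of_disjoint, Nat.card_Ico, Finset.card_range]
        · convert hdeg using 2
          omega
        · rw [Finset.disjoint_left]
          intro a ha hb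
          simp at ha hb; omega
      · intro r hr
        rw [Finset.mem_union, Finset.mem_Ico, Finset.mem_range] at hr
        rcases hr with hr | hr
        · rw [Lagrange.eval_interpolate_at_node _ hinj (by simp; omega)]
          apply h1; omega
        · have := hp r (by omega) (by omega) (by omega)
          unfold par at this
          rwa [Finset.sum_eq_zero, zero_add] at this
          intro j hj
          have := hjB j (Finset.mem_range.1 hj)
          apply h1; omega
    have := Lagrange.eval_interpolate_at_node (fun e => z ((n + 1) * B + e)) hinj
      (i := e) (by simp; omega)
    rw [hP] at this
    simpa using this.symm

end block

/-- first component parity -/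
noncomputable def parI {F : Type} [Field F] (B m f : ℕ) (x : ℕ → F) (β : ℤ)
    (a : ℕ → ℤ → F) (r : ℕ) (i : ℤ) : F :=
  par B m f x r (fun l => a l (i - ((m * B + f : ℕ) + r) * β + l * β))

/-- second component parity -/
noncomputable def parII {F : Type} [Field F] (B m f : ℕ) (x : ℕ → F) (g : ℤ)
    (a : ℕ → ℤ → F) (r : ℕ) (w : ℤ) : F :=
  par B m f x r (fun l => a (m * B + f - 1 - l) (w - ((m * B + f : ℕ) + r) * g + l * g))

/-- the transmitted parity -/
noncomputable def parQ {F : Type} [Field F] (B m f : ℕ) (x : ℕ → F) (β g : ℤ)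
    (a : ℕ → ℤ → F) (r : ℕ) (i : ℤ) : F :=
  parI B m f x β a r i + parII B m f x g a (B - 1 - r) (i - ((m * B + f : ℕ) + B) * β)

section core
variable {F : Type} [Field F] {B m f : ℕ} {x : ℕ → F} {β g : ℤ}

lemma parQ_sub (a a' : ℕ → ℤ → F) (r : ℕ) (i : ℤ) :
    parQ B m f x β g (fun k τ => a k τ - a' k τ) r i
      = parQ B m f x β g a r i - parQ B m f x β g a' r i := by
  unfold parQ parI parII
  simp only [par_sub]
  ring

/-- first component is clean when recent symbols vanish -/
lemma parI_zero (hm : 1 ≤ m) (hf : f < B) (hβ : 0 < β) (a : ℕ → ℤ → F) {r : ℕ} (hr : r < B)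
    (i : ℤ) (h : ∀ k < m * B + f, ∀ τ, i - (m * B + f : ℕ) * β ≤ τ → τ < i → a k τ = 0) :
    parI B m f x β a r i = 0 := by
  apply par_zero hm hf hr
  intro l h1 h2
  apply h l h2
  · have : (r : ℤ) * β ≤ l * β := by gcongr
    linarith
  · have h3 : (l : ℤ) + 1 ≤ (m * B + f : ℕ) + r := by omega
    have := mul_le_mul_of_nonneg_right h3 hβ.le
    linarith

/-- second component in terms of rows -/
lemma parII_zero (hm : 1 ≤ m) (hf : f < B) (a : ℕ → ℤ → F) {r : ℕ} (hr : r < B)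
    (w : ℤ) (h : ∀ k < m * B + f, a k (w - (k + 1 + r) * g) = 0) :
    parII B m f x g a r w = 0 := by
  apply par_zero hm hf hr
  intro l h1 h2
  have := h (m * B + f - 1 - l) (by omega)
  convert this using 2
  have e : ((m * B + f - 1 - l : ℕ) : ℤ) = (m * B + f : ℕ) - 1 - l := by omega
  rw [e]; ring

lemma parQ_congr (hm : 1 ≤ m) (hf : f < B) (hβ : 0 < β) (hg : 0 < g) (a a' : ℕ → ℤ → F) {r : ℕ}
    (hr : r < B) (i : ℤ) (h : ∀ k < m * B + f, ∀ τ, τ < i → a k τ = a' k τ) :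
    parQ B m f x β g a r i = parQ B m f x β g a' r i := by
  rw [← sub_eq_zero, ← parQ_sub]
  unfold parQ
  rw [parI_zero hm hf hβ _ hr, parII_zero hm hf _ (by omega), add_zero]
  · intro k hk
    rw [h k hk, sub_self]
    have : 0 ≤ ((m * B + f : ℕ) + B : ℤ) * β := by positivity
    have : 0 < ((k : ℤ) + 1 + (B - 1 - r : ℕ)) * g := by positivity
    linarith
  · intro k hk τ _ h2
    rw [h k hk τ h2, sub_self]

theorem core1 (hB : 1 ≤ B) (hm : 1 ≤ m) (hf : f < B) (hx : Set.InjOn x (Finset.range B))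
    (hβ : 0 < β) (hg : 0 < g) (a : ℕ → ℤ → F) (J L : ℤ)
    (h0 : ∀ k < m * B + f, ∀ τ ≤ L, ¬ (J ≤ τ ∧ τ < J + B * β) → a k τ = 0)
    (hq : ∀ r < B, ∀ i, J + B * β ≤ i → i ≤ L → parQ B m f x β g a r i = 0) :
    ∀ k < m * B + f, ∀ τ, τ + (m * B + f : ℕ) * β ≤ L → a k τ = 0 := by
  intro k
  induction k using Nat.strong_induction_on with
  | _ k ih =>
  intro hk τ hτ
  have hT : 0 ≤ ((m * B + f : ℕ) : ℤ) * β := by positivity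
  by_cases hin : J ≤ τ ∧ τ < J + B * β
  swap
  · exact h0 k hk τ (by linarith) hin
  have key := block_main hB hm hf hx (fun l => a l (τ - k * β + l * β)) k hk ?_ ?_ ?_
  · simpa using key
  · intro l hl
    have : (l : ℤ) * β ≤ k * β := by gcongr
    exact ih l hl (by omega) _ (by linarith)
  · intro l hl hl2
    have h3 : ((k : ℤ) + B) * β ≤ l * β := by gcongr; exact_mod_cast hl
    have h4 : (l : ℤ) * β ≤ (m * B + f : ℕ) * β := by gcongr
    have h5 : 0 ≤ (k : ℤ) * β := by positivity
    exact h0 l hl2 _ (by linarith) (by intro h; linarith [h.2])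
  · intro r hr hrk hrT
    have e1 : (r : ℤ) * β ≤ k * β := by gcongr
    have e2 : ((k : ℤ) + B) * β ≤ ((m * B + f : ℕ) + r) * β :=
      mul_le_mul_of_nonneg_right (by exact_mod_cast hrT) hβ.le
    have hQ := hq r hr (τ - k * β + ((m * B + f : ℕ) + r) * β) (by linarith) (by linarith)
    unfold parQ at hQ
    rw [parII_zero hm hf _ (by omega), add_zero] at hQ
    · unfold parI at hQ
      convert hQ using 4
      ring
    · intro k' hk'
      have : 0 < ((k' : ℤ) + 1 + (B - 1 - r : ℕ)) * g := by positivity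
      have e3 : 0 ≤ (B : ℤ) * β := by positivity
      apply h0 _ hk' _ (by linarith)
      intro h; linarith [h.1]

theorem core2 (hB : 1 ≤ B) (hm : 1 ≤ m) (hf : f < B) (hx : Set.InjOn x (Finset.range B))
    (hβ : 0 < β) (hg : 0 < g) (a : ℕ → ℤ → F) (J L : ℤ)
    (h0 : ∀ k < m * B + f, ∀ τ ≤ L, ¬ (J ≤ τ ∧ τ < J + B * (β + g)) → a k τ = 0)
    (hq : ∀ r < B, ∀ i, J + B * (β + g) ≤ i → i ≤ L → parQ B m f x β g a r i = 0) :
    ∀ k < m * B + f, ∀ τ, τ + (m * B + f : ℕ) * g + ((m * B + f : ℕ) + B) * β ≤ L →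
      a k τ = 0 := by
  have hBT : B ≤ m * B + f := by nlinarith
  obtain ⟨T, hT⟩ : ∃ T, T = m * B + f := ⟨_, rfl⟩
  rw [← hT] at h0 hBT ⊢
  have hTβ : 0 ≤ (T : ℤ) * β := by positivity
  have hBβ : 0 < (B : ℤ) * β := by positivity
  have hBg : 0 < (B : ℤ) * g := by positivity
  have main : ∀ n : ℕ, ∀ k < T, ∀ τ, τ + k * g < J + n →
      τ + k * g + (min (T - k) B : ℕ) * g + (T + B) * β ≤ L → a k τ = 0 := by
    intro n
    induction n with
    | zero =>
      intro k hk τ h1 h2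
      have : 0 ≤ (k : ℤ) * g := by positivity
      have : 0 ≤ ((min (T - k) B : ℕ) : ℤ) * g := by positivity
      push_cast at h1
      exact h0 k hk τ (by linarith) (by intro h; linarith [h.1])
    | succ n ih =>
    -- cleaning of the first-component parities on the line
    have clean : ∀ k < T, ∀ τ, τ + k * g < J + (n + 1 : ℕ) → τ + k * g + T * β ≤ L →
        J + B * g ≤ τ → ∀ r < B, r ≤ k → k + B ≤ T + r →
        par B m f x r (fun l => a l (τ - k * β + l * β)) = 0 := by
      intro k hk τ h1 h2 hτ r hr hrk hrT
      have hkg : 0 ≤ (k : ℤ) * g := by positivity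
      have e1 : (r : ℤ) * β ≤ k * β := by gcongr
      have e1' : (r : ℤ) * g ≤ k * g := by gcongr
      have e2 : ((k : ℤ) + B) * β ≤ (T + r) * β :=
        mul_le_mul_of_nonneg_right (by exact_mod_cast hrT) hβ.le
      have hQ := hq r hr (τ - k * β + (T + r) * β) (by linarith) (by linarith)
      unfold parQ at hQ
      rw [parII_zero hm hf _ (by omega), add_zero] at hQ
      · unfold parI at hQ
        rw [← hT] at hQ
        convert hQ using 4
        ring
      · intro k' hk'
        rw [← hT] at hk' ⊢
        have e3 : ((B - 1 - r : ℕ) : ℤ) = B - 1 - r := by omega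
        have e4 : ((min (T - k') B : ℕ) : ℤ) * g ≤ B * g := by gcongr; omega
        have e5 : (r : ℤ) * g ≤ B * g := by gcongr
        have e6 : 1 * 1 ≤ (B : ℤ) * β := by
          apply mul_le_mul <;> first | omega | positivity
        rw [e3]
        apply ih k' hk'
        · push_cast at h1; linarith
        · linarith
    -- low rows
    have low : ∀ k, k + B < T → ∀ τ, τ + k * g < J + (n + 1 : ℕ) → τ + k * g + T * β ≤ L →
        J + B * g ≤ τ → a k τ = 0 := by
      intro k hk τ h1 h2 hτ
      have hkg : 0 ≤ (k : ℤ) * g := by positivity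
      have key := block_low hB hf hx (fun l => a l (τ - k * β + l * β)) k (by omega) ?_ ?_
        (clean k (by omega) τ h1 h2 hτ _ (Nat.mod_lt _ hB) (Nat.mod_le _ _) (by omega))
      · simpa using key
      · intro l hl
        have e1 : ((l : ℤ) + B) * β ≤ k * β := by gcongr; exact_mod_cast hl
        have e2 : ((l : ℤ) + B) * g ≤ k * g := by gcongr; exact_mod_cast hl
        have e4 : ((min (T - l) B : ℕ) : ℤ) * g ≤ B * g := by gcongr; omega
        have e6 : 1 * 1 ≤ (B : ℤ) * β := by
          apply mul_le_mul <;> first | omega | positivity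
        apply ih l (by omega)
        · push_cast at h1; linarith
        · linarith
      · intro l hl hl2
        rw [← hT] at hl2
        have h3 : ((k : ℤ) + B) * β ≤ l * β := by gcongr; exact_mod_cast hl
        have h4 : (l : ℤ) * β ≤ T * β := by gcongr
        have h5 : 0 ≤ (k : ℤ) * β := by positivity
        exact h0 l hl2 _ (by linarith) (by intro h; linarith [h.2])
    -- the late part of the burst
    have late : ∀ k < T, ∀ τ, τ + k * g < J + (n + 1 : ℕ) →
        τ + k * g + (min (T - k) B : ℕ) * g + (T + B) * β ≤ L → J + B * g ≤ τ → a k τ = 0 := by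
      intro k hk τ h1 h2 hτ
      have hkg : 0 ≤ (k : ℤ) * g := by positivity
      have hmin : 0 ≤ ((min (T - k) B : ℕ) : ℤ) * g := by positivity
      have key := block_main hB hm hf hx (fun l => a l (τ - k * β + l * β)) k (by omega) ?_ ?_
        (fun r hr hrk hrT => clean k hk τ h1 (by linarith) hτ r hr hrk (by omega))
      · simpa using key
      · intro l hl
        have e1 : ((l : ℤ) + 1) * β ≤ k * β := by gcongr; exact_mod_cast hl
        have e2 : ((l : ℤ)) * g ≤ k * g := by gcongr
        have e4 : ((min (T - l) B : ℕ) : ℤ) * g ≤ ((min (T - k) B : ℕ) + (k - l)) * g := by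
          gcongr; omega
        apply ih l (by omega)
        · push_cast at h1; linarith
        · linarith
      · intro l hl hl2
        rw [← hT] at hl2
        have h3 : ((k : ℤ) + B) * β ≤ l * β := by gcongr; exact_mod_cast hl
        have h4 : (l : ℤ) * β ≤ T * β := by gcongr
        have h5 : 0 ≤ (k : ℤ) * β := by positivity
        exact h0 l hl2 _ (by linarith) (by intro h; linarith [h.2])
    -- the early part, by induction on the position in the second codeword
    have early : ∀ A < T, ∀ τ, τ + (T - 1 - A : ℕ) * g < J + (n + 1 : ℕ) →
        τ + (T - 1 - A : ℕ) * g + (min (A + 1) B : ℕ) * g + (T + B) * β ≤ L →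
        a (T - 1 - A) τ = 0 := by
      intro A
      induction A using Nat.strong_induction_on with
      | _ A ihA =>
      intro hA τ h1 h2
      have hmin : 0 ≤ ((min (A + 1) B : ℕ) : ℤ) * g := by positivity
      have hkg : 0 ≤ ((T - 1 - A : ℕ) : ℤ) * g := by positivity
      by_cases hlt : τ < J
      · exact h0 _ (by omega) τ (by linarith) (by intro h; linarith [h.1])
      by_cases hlate : J + B * g ≤ τ
      · refine late _ (by omega) τ h1 ?_ hlate
        rw [show T - (T - 1 - A) = A + 1 by omega]; exact h2
      have eA : ((T - 1 - A : ℕ) : ℤ) = T - 1 - A := by omega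
      rw [eA] at h1 h2 hkg
      have key := block_main hB hm hf hx (fun l => a (T - 1 - l) (τ - A * g + l * g)) A
        (by omega) ?_ ?_ ?_
      · simpa using key
      · intro l hl
        have el : ((T - 1 - l : ℕ) : ℤ) = T - 1 - l := by omega
        have e4 : ((min (l + 1) B : ℕ) : ℤ) * g ≤ (min (A + 1) B : ℕ) * g := by gcongr
        apply ihA l hl (by omega)
        · rw [el]; linarith
        · rw [el]; linarith
      · intro l hl hl2
        rw [← hT] at hl2
        have el : ((T - 1 - l : ℕ) : ℤ) = T - 1 - l := by omega
        have e4 : ((A : ℤ) + B) * g ≤ l * g := by gcongr; exact_mod_cast hl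
        apply low (T - 1 - l) (by omega)
        · rw [el]; linarith
        · rw [el]; linarith
        · linarith
      · intro r hr hrA hrT
        rw [← hT] at hrT
        have e1 : ((r : ℤ) + 1) * g ≤ (min (A + 1) B : ℕ) * g := by gcongr; omega
        have e2 : ((A : ℤ) + B) * g ≤ (T + r) * g :=
          mul_le_mul_of_nonneg_right (by exact_mod_cast hrT) hg.le
        have hQ := hq (B - 1 - r) (by omega) (τ - A * g + (T + r) * g + (T + B) * β)
          (by linarith) (by linarith)
        unfold parQ at hQ
        rw [parI_zero hm hf hβ _ (by omega), zero_add, ← hT,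
          show B - 1 - (B - 1 - r) = r by omega] at hQ
        · unfold parII at hQ
          rw [← hT] at hQ
          convert hQ using 4
          ring
        · intro k' hk' σ hσ1 hσ2
          rw [← hT] at hk' hσ1
          exact h0 _ hk' _ (by linarith) (by intro h; linarith [h.2])
    intro k hk τ h1 h2
    have := early (T - 1 - k) (by omega) τ
    rw [show T - 1 - (T - 1 - k) = k by omega, show T - 1 - k + 1 = T - k by omega] at this
    exact this h1 h2
  intro k hk τ h
  have e4 : ((min (T - k) B : ℕ) : ℤ) * g ≤ (T - k) * g := by gcongr; omega
  refine main ((τ + k * g - J).toNat + 1) k hk τ ?_ (by linarith)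
  have := Int.self_le_toNat (τ + k * g - J)
  push_cast; linarith

end core

lemma corrects_of {S X : Type} [Nonempty S] (f : ∀ t : ℕ, (Fin (t + 1) → S) → X) (B T : ℕ)
    (hB : 1 ≤ B)
    (h : ∀ (s s' : ℕ → S) (j t : ℕ), (∀ i ≤ t + T, ¬ (j ≤ i ∧ i < j + B) →
      chanStream f s i = chanStream f s' i) → s t = s' t) : Corrects f B T := by
  classical
  have key : ∀ (s s' : ℕ → S) (j j' t : ℕ),
      (∀ i ≤ t + T, burstOut f B j s i = burstOut f B j' s' i) → s t = s' t := by
    intro s s' j j' t hy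
    have hout : ∀ (s : ℕ → S) (j i : ℕ), (j ≤ i ∧ i < j + B) → burstOut f B j s i = none := by
      intro s j i hi
      unfold burstOut
      rw [if_pos (by omega)]
    have hout' : ∀ (s : ℕ → S) (j i : ℕ), ¬ (j ≤ i ∧ i < j + B) →
        burstOut f B j s i = some (chanStream f s i) := by
      intro s j i hi
      unfold burstOut
      rw [if_neg (by omega)]
    apply h s s' j t
    intro i hi hij
    have hji : ¬ (j' ≤ i ∧ i < j' + B) := by
      intro hc
      have := hy i hi
      rw [hout' s j i hij, hout s' j' i hc] at this
      simp at this
    have := hy i hi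
    rw [hout' s j i hij, hout' s' j' i hji] at this
    simpa using this
  refine ⟨fun t y => if hy : ∃ s : ℕ → S, ∃ j, y = fun i => burstOut f B j s i.val then
    hy.choose t else Classical.arbitrary S, ?_⟩
  intro s j t
  have hy : ∃ s' : ℕ → S, ∃ j', (fun i : Fin (t + T + 1) => burstOut f B j s i.val) =
    fun i => burstOut f B j' s' i.val := ⟨s, j, rfl⟩
  simp only [dif_pos hy]
  obtain ⟨j', hj'⟩ := hy.choose_spec
  symm
  apply key s _ j j' t
  intro i hi
  exact congrFun hj' ⟨i, by omega⟩

/-- Fine-time view of a source stream. -/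
noncomputable def fineA {F : Type} [Field F] {B T : ℕ} (s : ℕ → (Fin (B * T) → F))
    (k : ℕ) (τ : ℤ) : F :=
  if h : 0 ≤ τ ∧ k < T ∧ (τ % B).toNat < B then
    s (τ / B).toNat (finProdFinEquiv (⟨(τ % B).toNat, h.2.2⟩, ⟨k, h.2.1⟩)) else 0

lemma fineA_neg {F : Type} [Field F] {B T : ℕ} (s : ℕ → (Fin (B * T) → F))
    (k : ℕ) (τ : ℤ) (h : τ < 0) : fineA s k τ = 0 := by
  unfold fineA
  rw [dif_neg (by omega)]

lemma fineA_at {F : Type} [Field F] {B T : ℕ} (s : ℕ → (Fin (B * T) → F))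
    (t : ℕ) (ρ : Fin B) (k : Fin T) :
    fineA s k (t * B + (ρ : ℕ)) = s t (finProdFinEquiv (ρ, k)) := by
  have hρ := ρ.2
  have e1 : ((t : ℤ) * B + (ρ : ℕ)) % B = (ρ : ℕ) := by
    rw [add_comm, Int.add_mul_emod_self_right]
    exact Int.emod_eq_of_lt (by omega) (by omega)
  have e2 : ((t : ℤ) * B + (ρ : ℕ)) / B = t := by
    rw [add_comm, Int.add_mul_ediv_right _ _ (by omega), Int.ediv_eq_zero_of_lt] <;> omega
  unfold fineA
  simp only [e1, e2]
  rw [dif_pos ⟨by positivity, k.2, by simp⟩]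
  simp

lemma fine_split {B : ℕ} (hB : 1 ≤ B) (τ : ℤ) (h : 0 ≤ τ) :
    ∃ (t : ℕ) (ρ : Fin B), τ = t * B + (ρ : ℕ) := by
  lift τ to ℕ using h
  refine ⟨τ / B, ⟨τ % B, Nat.mod_lt _ hB⟩, ?_⟩
  have := Nat.div_add_mod' τ B
  exact_mod_cast this.symm

/-- The encoder written as a function of the full stream. -/
noncomputable def encS {F : Type} [Field F] (B m f : ℕ) (x : ℕ → F) (β g : ℤ)
    (s : ℕ → (Fin (B * (m * B + f)) → F)) (t : ℕ) : Fin (B * (m * B + f + B)) → F :=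
  fun idx =>
    if (finProdFinEquiv.symm idx).2.val < m * B + f then
      fineA s (finProdFinEquiv.symm idx).2.val (t * B + ((finProdFinEquiv.symm idx).1 : ℕ))
    else parQ B m f x β g (fineA s) ((finProdFinEquiv.symm idx).2.val - (m * B + f))
      (t * B + ((finProdFinEquiv.symm idx).1 : ℕ))

/-- The streaming encoder. -/
noncomputable def encF {F : Type} [Field F] (B m f : ℕ) (x : ℕ → F) (β g : ℤ) (t : ℕ)
    (v : Fin (t + 1) → (Fin (B * (m * B + f)) → F)) : Fin (B * (m * B + f + B)) → F :=
  encS B m f x β g (fun i => if h : i < t + 1 then v ⟨i, h⟩ else 0) t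

section glue
variable {F : Type} [Field F] {B m f : ℕ} {x : ℕ → F} {β g : ℤ}

lemma chan_eq (hB : 1 ≤ B) (hm : 1 ≤ m) (hf : f < B) (hβ : 0 < β) (hg : 0 < g)
    (s : ℕ → (Fin (B * (m * B + f)) → F)) (t : ℕ) :
    chanStream (encF B m f x β g) s t = encS B m f x β g s t := by
  have hfine : ∀ k < m * B + f, ∀ τ : ℤ, τ < (t + 1) * B →
      fineA (fun i => if h : i < t + 1 then s i else 0) k τ = fineA s k τ := by
    intro k hk τ hτ
    by_cases h0 : τ < 0
    · rw [fineA_neg _ _ _ h0, fineA_neg _ _ _ h0]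
    · obtain ⟨t', ρ, rfl⟩ := fine_split hB τ (by omega)
      have h1 := fineA_at (T := m * B + f) s t' ρ ⟨k, hk⟩
      have h2 := fineA_at (T := m * B + f)
        (fun i => if h : i < t + 1 then s i else 0) t' ρ ⟨k, hk⟩
      simp only at h1 h2
      rw [h1, h2, dif_pos]
      by_contra hc
      have : ((t : ℤ) + 1) * B ≤ t' * B := by gcongr; omega
      omega
  unfold chanStream encF
  funext idx
  have hρ := (finProdFinEquiv.symm idx).1.2
  have hy := (finProdFinEquiv.symm idx).2.2
  have e : ((t : ℤ) + 1) * B = t * B + B := by ring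
  unfold encS
  simp only
  split_ifs with hc
  · apply hfine _ hc
    omega
  · apply parQ_congr hm hf hβ hg _ _ (by omega)
    intro k hk τ hτ
    apply hfine k hk
    omega

lemma corrects_glue (hB : 1 ≤ B) (hm : 1 ≤ m) (hf : f < B) (hβ : 0 < β) (hg : 0 < g)
    (b d : ℕ) (hb : 1 ≤ b)
    (core : ∀ (a : ℕ → ℤ → F) (J L : ℤ),
      (∀ k < m * B + f, ∀ τ ≤ L, ¬ (J ≤ τ ∧ τ < J + b * B) → a k τ = 0) →
      (∀ r < B, ∀ i, J + b * B ≤ i → i ≤ L → parQ B m f x β g a r i = 0) →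
      ∀ k < m * B + f, ∀ τ, τ + d * B ≤ L → a k τ = 0) :
    Corrects (encF B m f x β g) b d := by
  apply corrects_of _ _ _ hb
  intro s s' j t hy
  simp only [chan_eq hB hm hf hβ hg] at hy
  -- translate fine times outside the burst to coarse times
  have htime : ∀ (t' : ℕ) (ρ : Fin B), ((t' : ℤ) * B + (ρ : ℕ) ≤ (t + d) * B + B - 1) →
      ¬ ((j : ℤ) * B ≤ t' * B + (ρ : ℕ) ∧ (t' : ℤ) * B + (ρ : ℕ) < j * B + b * B) →
      encS B m f x β g s t' = encS B m f x β g s' t' := by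
    intro t' ρ h1 h2
    have hρ := ρ.2
    apply hy
    · by_contra hc
      have : ((t : ℤ) + d + 1) * B ≤ t' * B := by gcongr; omega
      linarith
    · rintro ⟨h3, h4⟩
      apply h2
      have e1 : (j : ℤ) * B ≤ t' * B := by gcongr
      have e2 : ((t' : ℤ) + 1) * B ≤ (j + b) * B :=
        mul_le_mul_of_nonneg_right (by omega) (by omega)
      constructor
      · linarith
      · have : ((ρ : ℕ) : ℤ) < B := by exact_mod_cast hρ
        linarith
  funext idx
  obtain ⟨⟨ρ, k⟩, rfl⟩ := finProdFinEquiv.surjective idx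
  rw [← fineA_at s t ρ k, ← fineA_at s' t ρ k, ← sub_eq_zero]
  refine core (fun k τ => fineA s k τ - fineA s' k τ) (j * B) ((t + d) * B + B - 1) ?_ ?_ k k.2
    (t * B + (ρ : ℕ)) ?_
  · intro k hk τ h1 h2
    by_cases h0 : τ < 0
    · simp [fineA_neg _ _ _ h0]
    obtain ⟨t', ρ', rfl⟩ := fine_split hB τ (by omega)
    have := congrFun (htime t' ρ' h1 h2) (finProdFinEquiv (ρ', ⟨k, by omega⟩))
    unfold encS at this
    simp only [Equiv.symm_apply_apply, hk, if_true] at this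
    rw [sub_eq_zero]; exact this
  · intro r hr i h1 h2
    have : 0 ≤ (j : ℤ) * B := by positivity
    have : 0 ≤ (b : ℤ) * B := by positivity
    obtain ⟨t', ρ', rfl⟩ := fine_split hB i (by linarith)
    have := congrFun (htime t' ρ' h2 (by intro h; linarith [h.2]))
      (finProdFinEquiv (ρ', ⟨m * B + f + r, by omega⟩))
    unfold encS at this
    simp only [Equiv.symm_apply_apply] at this
    rw [if_neg (by omega), if_neg (by omega), Nat.add_sub_cancel_left] at this
    rw [parQ_sub, sub_eq_zero]; exact this
  · have := ρ.2
    have : ((ρ : ℕ) : ℤ) + 1 ≤ B := by exact_mod_cast this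
    linarith

end glue

/-- DE-SCo for general (possibly non-integer) `α = B₂/B`: for `T ≥ B ≥ 1` and `B₂ > B`
there exist a finite field `F` and a rate-`T/(T+B)` streaming code correcting bursts of
length `B` with delay `T` and bursts of length `B₂` with delay `⌈B₂·T/B⌉ + B`. -/
theorem stmt_14 (B T B₂ : ℕ) (hB : 1 ≤ B) (hBT : B ≤ T) (hB₂ : B < B₂) :
    ∃ (F : Type) (_ : Field F) (_ : Fintype F) (k n : ℕ),
      0 < k ∧ 0 < n ∧ (k : ℚ) / (n : ℚ) = (T : ℚ) / ((T : ℚ) + (B : ℚ)) ∧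
      ∃ f : ∀ t : ℕ, (Fin (t + 1) → (Fin k → F)) → (Fin n → F),
        Corrects f B T ∧ Corrects f B₂ (⌈((B₂ : ℚ) * (T : ℚ)) / (B : ℚ)⌉₊ + B) := by
  obtain ⟨p, hpB, hp⟩ := Nat.exists_infinite_primes (B + 1)
  haveI : Fact p.Prime := ⟨hp⟩
  obtain ⟨m, f, hm, hf, hT⟩ : ∃ m f, 1 ≤ m ∧ f < B ∧ T = m * B + f :=
    ⟨T / B, T % B, (Nat.one_le_div_iff hB).2 hBT, Nat.mod_lt _ hB, (Nat.div_add_mod' T B).symm⟩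
  subst hT
  have hx : Set.InjOn (fun n : ℕ => (n : ZMod p)) (Finset.range B) := by
    intro a ha b hb hab
    have ha' : a < B := by simpa using ha
    have hb' : b < B := by simpa using hb
    have h := (ZMod.natCast_eq_natCast_iff' a b p).1 hab
    rwa [Nat.mod_eq_of_lt (by omega), Nat.mod_eq_of_lt (by omega)] at h
  have hβ : (0 : ℤ) < B := by exact_mod_cast hB
  have hg : (0 : ℤ) < (B₂ : ℤ) - B := by omega
  refine ⟨ZMod p, inferInstance, inferInstance, B * (m * B + f), B * (m * B + f + B),
    Nat.mul_pos hB (by omega), Nat.mul_pos hB (by omega), ?_,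
    encF B m f (fun n : ℕ => (n : ZMod p)) B ((B₂ : ℤ) - B), ?_, ?_⟩
  · have : (B : ℚ) ≠ 0 := by positivity
    push_cast
    rw [mul_div_mul_left _ _ this]
  · apply corrects_glue hB hm hf hβ hg _ _ hB
    intro a J L h0 hq
    exact core1 hB hm hf hx hβ hg a J L h0 hq
  · apply corrects_glue hB hm hf hβ hg _ _ (by omega)
    intro a J L h0 hq k hk τ hτ
    have e : (B : ℤ) * (B + (B₂ - B)) = B₂ * B := by ring
    refine core2 hB hm hf hx hβ hg a J L ?_ ?_ k hk τ ?_
    · rw [e]; exact h0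
    · rw [e]; exact hq
    · refine le_trans ?_ hτ
      have hc := Nat.le_ceil (((B₂ : ℚ) * ((m * B + f : ℕ) : ℚ)) / (B : ℚ))
      rw [div_le_iff₀ (by positivity)] at hc
      have hc' : (B₂ : ℤ) * (m * B + f : ℕ) ≤
          (⌈((B₂ : ℚ) * ((m * B + f : ℕ) : ℚ)) / (B : ℚ)⌉₊ : ℤ) * B := by exact_mod_cast hc
      rw [Nat.cast_add (⌈((B₂ : ℚ) * ((m * B + f : ℕ) : ℚ)) / (B : ℚ)⌉₊)]
      nlinarith [hc']
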